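/- The sign function admits a decomposition sign = a + b into a regular part and an irregular part, where a : ℝ → ℝ is twice continuously differentiable with a, its first derivative, and its second derivative all bounded, b : ℝ → ℝ is Lebesgue integrable on ℝ, and for every κ ∈ (0, 1/2) the fractional Sobolev–Slobodeckij seminorm of b of order κ is finite, i.e. ∫_ℝ ∫_ℝ |b(x) − b(y)|² / |x − y|^(2κ+1) dx dy < ∞. -/

import Mathlib

open MeasureTheory

/-- `min 1 |h| / |h| ^ p` is integrable on `ℝ` for `1 < p < 2`. -/
lemma integrable_min_one_abs_div_abs_rpow {p : ℝ} (hp₁ : 1 < p) (hp₂ : p < 2) :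
    Integrable (fun h : ℝ => min 1 |h| / |h| ^ p) volume := by
  have hsmall : IntegrableOn (fun h : ℝ => min 1 |h| / |h| ^ p) (Set.Ioc 0 1) := by
    have h := (intervalIntegral.intervalIntegrable_rpow' (a := 0) (b := 1)
      (r := 1 - p) (by linarith)).1
    refine h.congr_fun (fun x hx => ?_) measurableSet_Ioc
    simp only [abs_of_pos hx.1, min_eq_right hx.2]
    rw [Real.rpow_sub hx.1, Real.rpow_one]
  have hlarge : IntegrableOn (fun h : ℝ => min 1 |h| / |h| ^ p) (Set.Ioi 1) := by
    refine (integrableOn_Ioi_rpow_of_lt (a := -p) (by linarith) one_pos).congr_fun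
      (fun x hx => ?_) measurableSet_Ioi
    have hx' : (1 : ℝ) < x := hx
    have hx0 : 0 < x := by linarith
    simp only [abs_of_pos hx0, min_eq_left hx'.le]
    rw [Real.rpow_neg hx0.le, one_div]
  have hpos : IntegrableOn (fun h : ℝ => min 1 |h| / |h| ^ p) (Set.Ioi 0) := by
    rw [← Set.Ioc_union_Ioi_eq_Ioi zero_le_one]
    exact hsmall.union hlarge
  have hneg : IntegrableOn (fun h : ℝ => min 1 |h| / |h| ^ p) (Set.Iic 0) := by
    rw [integrableOn_Iic_iff_integrableOn_Iio]
    rw [← neg_zero] at hpos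
    simpa using hpos.comp_neg_Iio
  rw [← integrableOn_univ, ← Set.Iic_union_Ioi (a := (0 : ℝ))]
  exact hneg.union hpos

/-- If the squared `L²` modulus of continuity of `b` at step `h` is at most `K * min 1 |h|`, then
the Sobolev–Slobodeckij seminorm of `b` of any order `κ ∈ (0, 1/2)` is finite. -/
lemma lintegral_slobodeckij_lt_top {b : ℝ → ℝ} (hb : Measurable b) {K : ℝ}
    (hK : ∀ h : ℝ, ∫⁻ x : ℝ, ENNReal.ofReal (|b x - b (x + h)| ^ 2) ≤
      ENNReal.ofReal (K * min 1 |h|))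
    {κ : ℝ} (hκ : κ ∈ Set.Ioo (0 : ℝ) (1/2)) :
    (∫⁻ x : ℝ, ∫⁻ y : ℝ,
        ENNReal.ofReal (|b x - b y| ^ 2 / |x - y| ^ (2 * κ + 1))) < ⊤ := by
  have hint := (integrable_min_one_abs_div_abs_rpow (p := 2 * κ + 1)
    (by linarith [hκ.1]) (by linarith [hκ.2])).const_mul K
  calc (∫⁻ x : ℝ, ∫⁻ y : ℝ, ENNReal.ofReal (|b x - b y| ^ 2 / |x - y| ^ (2 * κ + 1)))
      = ∫⁻ x : ℝ, ∫⁻ h : ℝ,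
          ENNReal.ofReal (|b x - b (x + h)| ^ 2 / |h| ^ (2 * κ + 1)) := by
        refine lintegral_congr fun x => ?_
        rw [← lintegral_add_left_eq_self _ x]
        simp
    _ = ∫⁻ h : ℝ, ∫⁻ x : ℝ,
          ENNReal.ofReal (|b x - b (x + h)| ^ 2 / |h| ^ (2 * κ + 1)) := by
        refine lintegral_lintegral_swap (Measurable.aemeasurable ?_)
        unfold Function.uncurry
        fun_prop
    _ ≤ ∫⁻ h : ℝ, ENNReal.ofReal (K * (min 1 |h| / |h| ^ (2 * κ + 1))) := by
        refine lintegral_mono fun h => ?_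
        have hinv : 0 ≤ (|h| ^ (2 * κ + 1))⁻¹ := by positivity
        simp only [div_eq_mul_inv]
        simp only [← mul_assoc, ENNReal.ofReal_mul' hinv]
        rw [lintegral_mul_const _ (by fun_prop)]
        gcongr
        exact hK h
    _ < ⊤ := hint.lintegral_lt_top

lemma measurable_real_sign : Measurable Real.sign := by
  unfold Real.sign
  exact Measurable.ite measurableSet_Iio measurable_const
    (Measurable.ite measurableSet_Ioi measurable_const measurable_const)

lemma abs_real_sign_le_one (x : ℝ) : |Real.sign x| ≤ 1 := by
  rcases Real.sign_apply_eq x with h | h | h <;> simp [h]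

lemma real_sign_eq_of_abs_sub_lt {x y : ℝ} (h : |x - y| < |x|) : Real.sign x = Real.sign y := by
  rcases lt_trichotomy x 0 with hx | rfl | hx
  · rw [abs_of_neg hx, abs_lt] at h
    rw [Real.sign_of_neg hx, Real.sign_of_neg (by linarith)]
  · exact absurd h (by simp)
  · rw [abs_of_pos hx, abs_lt] at h
    rw [Real.sign_of_pos hx, Real.sign_of_pos (by linarith)]

/-- A `1`-bounded Lipschitz function agreeing with the sign function outside `[-1, 1]` differs from
it by a function whose squared `L²` modulus of continuity is linear at small steps. -/
lemma lintegral_sq_sub_translate_sign_sub_le {a : ℝ → ℝ} {L : ℝ}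
    (ha₁ : ∀ x, |a x| ≤ 1) (hL : ∀ x y, |a x - a y| ≤ L * |x - y|)
    (hsupp : ∀ x, 1 < |x| → Real.sign x - a x = 0) (h : ℝ) :
    ∫⁻ x : ℝ, ENNReal.ofReal
        (|(Real.sign x - a x) - (Real.sign (x + h) - a (x + h))| ^ 2) ≤
      ENNReal.ofReal ((16 * L + 64) * min 1 |h|) := by
  have hL0 : 0 ≤ L := by simpa using (abs_nonneg _).trans (hL 1 0)
  set b : ℝ → ℝ := fun x => Real.sign x - a x with hb
  have hb2 : ∀ x, |b x| ≤ 2 := fun x =>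
    (abs_sub _ _).trans (by linarith [ha₁ x, abs_real_sign_le_one x])
  have hb4 : ∀ x y, |b x - b y| ≤ 4 := fun x y =>
    (abs_sub _ _).trans (by linarith [hb2 x, hb2 y])
  have hbound : ∀ {s t : Set ℝ} {c d : ℝ}, 0 ≤ c → 0 ≤ d →
      (∀ x, |b x - b (x + h)| ^ 2 ≤ s.indicator (fun _ => c) x + t.indicator (fun _ => d) x) →
      MeasurableSet s → MeasurableSet t →
      ∫⁻ x : ℝ, ENNReal.ofReal (|b x - b (x + h)| ^ 2) ≤
        ENNReal.ofReal c * volume s + ENNReal.ofReal d * volume t := by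
    intro s t c d hc hd hle hs ht
    calc ∫⁻ x : ℝ, ENNReal.ofReal (|b x - b (x + h)| ^ 2)
        ≤ ∫⁻ x : ℝ, (s.indicator (fun _ => ENNReal.ofReal c) x +
            t.indicator (fun _ => ENNReal.ofReal d) x) := by
          refine lintegral_mono fun x => (ENNReal.ofReal_le_ofReal (hle x)).trans ?_
          refine ENNReal.ofReal_add_le.trans (le_of_eq ?_)
          by_cases h1 : x ∈ s <;> by_cases h2 : x ∈ t <;> simp [h1, h2]
      _ = _ := by
          rw [lintegral_add_left (measurable_const.indicator hs), lintegral_indicator_const hs,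
            lintegral_indicator_const ht]
  rcases le_or_gt |h| 1 with hh | hh
  · refine (hbound (s := Set.Icc (-2) 2) (t := Set.Icc (-|h|) |h|) (c := 4 * L * |h|) (d := 8)
      (by positivity) (by norm_num) (fun x => ?_) measurableSet_Icc measurableSet_Icc).trans ?_
    · have hlin : |b x - b (x + h)| ≤ L * |h| + |Real.sign x - Real.sign (x + h)| := by
        have h1 := hL x (x + h)
        rw [sub_add_cancel_left, abs_neg] at h1
        have h2 : b x - b (x + h) =
            (Real.sign x - Real.sign (x + h)) - (a x - a (x + h)) := by simp only [hb]; ring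
        rw [h2]
        exact (abs_sub _ _).trans (by linarith)
      have hsq : |b x - b (x + h)| ^ 2 ≤ 4 * |b x - b (x + h)| := by
        nlinarith [hb4 x (x + h), abs_nonneg (b x - b (x + h))]
      have hLh : 0 ≤ L * |h| := by positivity
      by_cases hx : x ∈ Set.Icc (-2 : ℝ) 2
      · rw [Set.indicator_of_mem hx]
        by_cases hx' : x ∈ Set.Icc (-|h|) |h|
        · rw [Set.indicator_of_mem hx']
          have h3 : |Real.sign x - Real.sign (x + h)| ≤ 2 := (abs_sub _ _).trans
            (by linarith [abs_real_sign_le_one x, abs_real_sign_le_one (x + h)])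
          linarith
        · rw [Set.indicator_of_notMem hx']
          rw [Set.mem_Icc, ← abs_le, not_le] at hx'
          have h3 : Real.sign x = Real.sign (x + h) :=
            real_sign_eq_of_abs_sub_lt (by simpa using hx')
          rw [h3, sub_self, abs_zero] at hlin
          linarith
      · rw [Set.mem_Icc, ← abs_le, not_le] at hx
        have h1 : b x = 0 := hsupp x (by linarith)
        have h2 : b (x + h) = 0 := hsupp _ (by
          have := abs_add_le (x + h) (-h)
          rw [add_neg_cancel_right, abs_neg] at this
          linarith)
        rw [h1, h2, sub_zero, abs_zero, zero_pow two_ne_zero]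
        exact add_nonneg (Set.indicator_nonneg (fun _ _ => by positivity) _)
          (Set.indicator_nonneg (fun _ _ => by norm_num) _)
    · rw [Real.volume_Icc, Real.volume_Icc, ← ENNReal.ofReal_mul (by positivity),
        ← ENNReal.ofReal_mul (by norm_num), ← ENNReal.ofReal_add (by positivity)
          (by ring_nf; positivity), min_eq_right hh]
      exact ENNReal.ofReal_le_ofReal (by linarith [abs_nonneg h])
  · refine (hbound (s := Set.Icc (-1) 1) (t := Set.Icc (-1 - h) (1 - h)) (c := 16) (d := 16)
      (by norm_num) (by norm_num) (fun x => ?_) measurableSet_Icc measurableSet_Icc).trans ?_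
    · have hsq : |b x - b (x + h)| ^ 2 ≤ 16 := by
        nlinarith [hb4 x (x + h), abs_nonneg (b x - b (x + h))]
      have hnn : ∀ s : Set ℝ, 0 ≤ s.indicator (fun _ => (16 : ℝ)) x := fun s =>
        Set.indicator_nonneg (fun _ _ => by norm_num) _
      by_cases hx : x ∈ Set.Icc (-1 : ℝ) 1
      · rw [Set.indicator_of_mem hx]
        linarith [hnn (Set.Icc (-1 - h) (1 - h))]
      by_cases hx' : x ∈ Set.Icc (-1 - h) (1 - h)
      · rw [Set.indicator_of_mem hx']
        linarith [hnn (Set.Icc (-1) 1)]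
      have h1 : b x = 0 := hsupp x (by rwa [Set.mem_Icc, ← abs_le, not_le] at hx)
      have h2 : b (x + h) = 0 := hsupp _ (by
        rwa [Set.mem_Icc, sub_le_iff_le_add, le_sub_iff_add_le, ← abs_le, not_le] at hx')
      rw [h1, h2, sub_zero, abs_zero, zero_pow two_ne_zero]
      exact add_nonneg (hnn _) (hnn _)
    · rw [Real.volume_Icc, Real.volume_Icc, ← ENNReal.ofReal_mul (by norm_num),
        ← ENNReal.ofReal_mul (by norm_num), ← ENNReal.ofReal_add (by norm_num)
          (by ring_nf; norm_num), min_eq_left hh.le]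
      exact ENNReal.ofReal_le_ofReal (by linarith)

/-- The smooth monotone approximation of the sign function, equal to it outside `(-1, 1)`. -/
noncomputable def smoothSign (x : ℝ) : ℝ := 2 * Real.smoothTransition ((x + 1) / 2) - 1

lemma contDiff_smoothSign {n : ℕ∞} : ContDiff ℝ n smoothSign :=
  (contDiff_const.mul (Real.smoothTransition.contDiff.comp
    ((contDiff_id.add contDiff_const).div_const 2))).sub contDiff_const

lemma abs_smoothSign_le_one (x : ℝ) : |smoothSign x| ≤ 1 := by
  have h₀ := Real.smoothTransition.nonneg ((x + 1) / 2)
  have h₁ := Real.smoothTransition.le_one ((x + 1) / 2)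
  rw [smoothSign, abs_le]
  constructor <;> linarith

lemma smoothSign_of_one_le {x : ℝ} (hx : 1 ≤ x) : smoothSign x = 1 := by
  rw [smoothSign, Real.smoothTransition.one_of_one_le (by linarith)]
  norm_num

lemma smoothSign_of_le_neg_one {x : ℝ} (hx : x ≤ -1) : smoothSign x = -1 := by
  rw [smoothSign, Real.smoothTransition.zero_of_nonpos (by linarith)]
  norm_num

lemma sign_sub_smoothSign_eq_zero {x : ℝ} (hx : 1 < |x|) : Real.sign x - smoothSign x = 0 := by
  rcases lt_abs.1 hx with h | h
  · rw [Real.sign_of_pos (by linarith), smoothSign_of_one_le h.le, sub_self]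
  · rw [Real.sign_of_neg (by linarith), smoothSign_of_le_neg_one (by linarith), sub_self]

lemma hasCompactSupport_deriv_smoothSign : HasCompactSupport (deriv smoothSign) := by
  refine HasCompactSupport.intro (isCompact_Icc (a := (-1 : ℝ)) (b := 1)) fun x hx => ?_
  rw [Set.mem_Icc, ← abs_le, not_le] at hx
  rcases lt_abs.1 hx with h | h
  · have : smoothSign =ᶠ[nhds x] fun _ => 1 := by
      filter_upwards [Ioi_mem_nhds h] with y hy using smoothSign_of_one_le (le_of_lt hy)
    rw [this.deriv_eq, deriv_const]
  · have : smoothSign =ᶠ[nhds x] fun _ => -1 := by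
      filter_upwards [Iio_mem_nhds (lt_neg_of_lt_neg h)] with y hy using
        smoothSign_of_le_neg_one (le_of_lt hy)
    rw [this.deriv_eq, deriv_const]

lemma integrable_sign_sub_smoothSign :
    Integrable (fun x => Real.sign x - smoothSign x) volume := by
  have hmeas : Measurable fun x => Real.sign x - smoothSign x :=
    measurable_real_sign.sub (contDiff_smoothSign (n := 0)).continuous.measurable
  have hon : IntegrableOn (fun x => Real.sign x - smoothSign x) (Set.Icc (-1) 1) volume :=
    Measure.integrableOn_of_bounded (M := 2) (by simp) hmeas.aestronglyMeasurable
      (Filter.Eventually.of_forall fun x => (abs_sub _ _).trans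
        (by linarith [abs_real_sign_le_one x, abs_smoothSign_le_one x]))
  refine hon.integrable_of_forall_notMem_eq_zero fun x hx => sign_sub_smoothSign_eq_zero ?_
  rwa [Set.mem_Icc, ← abs_le, not_le] at hx

/-- The sign function decomposes as `sign = a + b` where `a` is `C²` with `a`,
`a'`, `a''` all bounded, `b` is Lebesgue integrable on `ℝ`, and for every
`κ ∈ (0, 1/2)` the fractional Sobolev–Slobodeckij seminorm of `b` of order `κ`
is finite: `∫_ℝ ∫_ℝ |b x − b y|² / |x − y|^(2κ+1) dx dy < ∞`. -/
theorem sign_decomposition_regular_irregular :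
    ∃ a b : ℝ → ℝ,
      (∀ x : ℝ, Real.sign x = a x + b x) ∧
      ContDiff ℝ 2 a ∧
      (∃ C : ℝ, ∀ x : ℝ, |a x| ≤ C) ∧
      (∃ C : ℝ, ∀ x : ℝ, |deriv a x| ≤ C) ∧
      (∃ C : ℝ, ∀ x : ℝ, |deriv (deriv a) x| ≤ C) ∧
      Integrable b volume ∧
      ∀ κ ∈ Set.Ioo (0 : ℝ) (1/2),
        (∫⁻ x : ℝ, ∫⁻ y : ℝ,
            ENNReal.ofReal (|b x - b y| ^ 2 / |x - y| ^ (2 * κ + 1))) < ⊤ := by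
  have hd : ContDiff ℝ 1 (deriv smoothSign) :=
    (contDiff_smoothSign (n := 2)).deriv' (n := 1)
  obtain ⟨L, hL⟩ := hd.continuous.bounded_above_of_compact_support
    hasCompactSupport_deriv_smoothSign
  obtain ⟨M, hM⟩ := (hd.continuous_deriv le_rfl).bounded_above_of_compact_support
    hasCompactSupport_deriv_smoothSign.deriv
  have hlip : ∀ x y, |smoothSign x - smoothSign y| ≤ L * |x - y| := fun x y =>
    convex_univ.norm_image_sub_le_of_norm_deriv_le
      (fun z _ => (contDiff_smoothSign (n := 1)).differentiable (by simp) z)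
      (fun z _ => hL z) (Set.mem_univ y) (Set.mem_univ x)
  refine ⟨smoothSign, fun x => Real.sign x - smoothSign x, fun x => by ring,
    contDiff_smoothSign, ⟨1, abs_smoothSign_le_one⟩, ⟨L, hL⟩, ⟨M, hM⟩,
    integrable_sign_sub_smoothSign, fun κ hκ => ?_⟩
  exact lintegral_slobodeckij_lt_top
    (measurable_real_sign.sub (contDiff_smoothSign (n := 0)).continuous.measurable)
    (lintegral_sq_sub_translate_sign_sub_le abs_smoothSign_le_one hlip
      fun _ => sign_sub_smoothSign_eq_zero) hκ
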